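/- Under the hypotheses of the full-feedback second-order theorem (Theorem thm:12), if additionally Δ_t ≤ Δ for all 1 ≤ t ≤ T (where Δ_t = max_m l_{t,m} − min_m l_{t,m}), then the regret satisfies ∑_{t=1}^T ( ∑_{m=1}^M p_{t,m}·l_{t,m} − l_{t,ℓ_t(λ_t)} ) ≤ 6·Δ·√(W·T). -/

import Mathlib

/-- For nonnegative reals, `exp (-x)` is bounded by its second-order Taylor polynomial. -/
theorem exp_neg_le_quadratic {x : ℝ} (hx : 0 ≤ x) :
    Real.exp (-x) ≤ 1 - x + x ^ 2 / 2 := by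
  have h := Real.quadratic_le_exp_of_nonneg hx
  have hpos : 0 < Real.exp (-x) := Real.exp_pos _
  have hmul : Real.exp (-x) * Real.exp x = 1 := by rw [← Real.exp_add]; simp
  have h1 : Real.exp (-x) * (1 + x + x ^ 2 / 2) ≤ 1 :=
    (mul_le_mul_of_nonneg_left h hpos.le).trans_eq hmul
  have h2 : 0 < 1 + x + x ^ 2 / 2 := by positivity
  have h3 : (1 - x + x ^ 2 / 2) * (1 + x + x ^ 2 / 2) = 1 + x ^ 4 / 4 := by ring
  have h4 : 0 ≤ x ^ 4 / 4 := by positivity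
  exact le_of_mul_le_mul_right (by linarith) h2

/-- Second-order bound of the weighted average loss by the mix loss. -/
theorem mean_le_mixLoss_add_sq {ι : Type*} (s : Finset ι) (w x : ι → ℝ) {η : ℝ} (hη : 0 < η)
    (hw : ∀ a ∈ s, 0 ≤ w a) (hx : ∀ a ∈ s, 0 ≤ x a) (hP : 0 < ∑ a ∈ s, w a) :
    (∑ a ∈ s, w a * x a) / ∑ a ∈ s, w a ≤
      (Real.log (∑ a ∈ s, w a) - Real.log (∑ a ∈ s, w a * Real.exp (-η * x a))) / η +
        η / 2 * ((∑ a ∈ s, w a * x a ^ 2) / ∑ a ∈ s, w a) := by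
  set P := ∑ a ∈ s, w a with hPdef
  set R := ∑ a ∈ s, w a * Real.exp (-η * x a) with hR
  have hRpos : 0 < R := by
    obtain ⟨a, ha, hwa⟩ := Finset.exists_lt_of_sum_lt (f := fun _ => (0 : ℝ)) (g := w) (s := s)
      (by simpa using hP)
    exact Finset.sum_pos' (fun b hb => mul_nonneg (hw b hb) (Real.exp_pos _).le)
      ⟨a, ha, mul_pos hwa (Real.exp_pos _)⟩
  have hRle : R ≤ P - η * (∑ a ∈ s, w a * x a) + η ^ 2 / 2 * ∑ a ∈ s, w a * x a ^ 2 := by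
    rw [hR, hPdef, Finset.mul_sum, Finset.mul_sum, ← Finset.sum_sub_distrib,
      ← Finset.sum_add_distrib]
    refine Finset.sum_le_sum fun a ha => ?_
    have h := mul_le_mul_of_nonneg_left
      (exp_neg_le_quadratic (mul_nonneg hη.le (hx a ha))) (hw a ha)
    rw [neg_mul]
    linarith
  have hlog : Real.log R - Real.log P ≤ R / P - 1 := by
    rw [← Real.log_div hRpos.ne' hP.ne']
    exact Real.log_le_sub_one_of_pos (by positivity)
  have hdiv : R / P ≤ 1 - η * ((∑ a ∈ s, w a * x a) / P) +
      η ^ 2 / 2 * ((∑ a ∈ s, w a * x a ^ 2) / P) := by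
    rw [div_le_iff₀ hP]
    have : (1 - η * ((∑ a ∈ s, w a * x a) / P) +
      η ^ 2 / 2 * ((∑ a ∈ s, w a * x a ^ 2) / P)) * P =
      P - η * (∑ a ∈ s, w a * x a) + η ^ 2 / 2 * ∑ a ∈ s, w a * x a ^ 2 := by
      field_simp
    rw [this]; exact hRle
  have key : η * ((∑ a ∈ s, w a * x a) / P) ≤ (Real.log P - Real.log R) +
      η ^ 2 / 2 * ((∑ a ∈ s, w a * x a ^ 2) / P) := by linarith
  refine le_of_mul_le_mul_left (key.trans_eq ?_) hη
  field_simp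

/-- First-order bound of the weighted average loss by the mix loss. -/
theorem mean_le_mixLoss_add_sqrt {ι : Type*} (s : Finset ι) (w x : ι → ℝ) {η : ℝ} (hη : 0 < η)
    (hw : ∀ a ∈ s, 0 ≤ w a) (hx : ∀ a ∈ s, 0 ≤ x a) (hP : 0 < ∑ a ∈ s, w a) :
    (∑ a ∈ s, w a * x a) / ∑ a ∈ s, w a ≤
      (Real.log (∑ a ∈ s, w a) - Real.log (∑ a ∈ s, w a * Real.exp (-η * x a))) / η +
        Real.sqrt ((∑ a ∈ s, w a * x a ^ 2) / ∑ a ∈ s, w a) := by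
  have hRpos : 0 < ∑ a ∈ s, w a * Real.exp (-η * x a) := by
    obtain ⟨a, ha, hwa⟩ := Finset.exists_lt_of_sum_lt (f := fun _ => (0 : ℝ)) (g := w) (s := s)
      (by simpa using hP)
    exact Finset.sum_pos' (fun b hb => mul_nonneg (hw b hb) (Real.exp_pos _).le)
      ⟨a, ha, mul_pos hwa (Real.exp_pos _)⟩
  have hRle : ∑ a ∈ s, w a * Real.exp (-η * x a) ≤ ∑ a ∈ s, w a := by
    refine Finset.sum_le_sum fun a ha => mul_le_of_le_one_right (hw a ha) ?_
    rw [Real.exp_le_one_iff, neg_mul]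
    exact neg_nonpos.mpr (mul_nonneg hη.le (hx a ha))
  have hnonneg : 0 ≤ (Real.log (∑ a ∈ s, w a) -
      Real.log (∑ a ∈ s, w a * Real.exp (-η * x a))) / η :=
    div_nonneg (sub_nonneg.mpr (Real.log_le_log hRpos hRle)) hη.le
  have hcs : (∑ a ∈ s, w a * x a) ^ 2 ≤ (∑ a ∈ s, w a) * ∑ a ∈ s, w a * x a ^ 2 :=
    Finset.sum_sq_le_sum_mul_sum_of_sq_le_mul s hw
      (fun a ha => mul_nonneg (hw a ha) (sq_nonneg _)) (fun a _ => le_of_eq (by ring))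
  have : (∑ a ∈ s, w a * x a) / ∑ a ∈ s, w a ≤
      Real.sqrt ((∑ a ∈ s, w a * x a ^ 2) / ∑ a ∈ s, w a) := by
    apply Real.le_sqrt_of_sq_le
    rw [div_pow, div_le_div_iff₀ (by positivity) hP]
    nlinarith
  linarith

/-- One-step growth of the square root of a sum dominates the minimum of the two gap bounds. -/
theorem le_add_two_mul_sqrt_sub_sqrt {W U v η e m : ℝ} (hW : 1 ≤ W) (hU : 0 ≤ U) (hv : 0 ≤ v)
    (hη : 0 < U → η ≤ Real.sqrt W / Real.sqrt U)
    (h₁ : e ≤ m + η / 2 * v) (h₂ : e ≤ m + Real.sqrt v) :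
    e ≤ m + 2 * Real.sqrt W * (Real.sqrt (U + v) - Real.sqrt U) := by
  have hW1 : 1 ≤ Real.sqrt W := Real.one_le_sqrt.mpr hW
  set k := Real.sqrt W
  set A := Real.sqrt (U + v)
  set B := Real.sqrt U
  have hA0 : 0 ≤ A := Real.sqrt_nonneg _
  have hB0 : 0 ≤ B := Real.sqrt_nonneg _
  have hA : A ^ 2 = U + v := Real.sq_sqrt (by positivity)
  have hB : B ^ 2 = U := Real.sq_sqrt hU
  have hBA : B ≤ A := Real.sqrt_le_sqrt (by linarith)
  rcases le_or_gt (2 * B) A with h | h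
  · have hvA : Real.sqrt v ≤ A := Real.sqrt_le_sqrt (by linarith)
    nlinarith [mul_le_mul_of_nonneg_right hW1 (sub_nonneg.mpr hBA)]
  · have hBpos : 0 < B := by linarith
    have hUpos : 0 < U := by rw [← hB]; positivity
    have h3 := hη hUpos
    rw [le_div_iff₀ hBpos] at h3
    have hv' : v = (A - B) * (A + B) := by nlinarith
    have h4 : η / 2 * v ≤ 2 * k * (A - B) := by
      rcases le_or_gt η 0 with h5 | h5
      · have : η / 2 * v ≤ 0 := mul_nonpos_of_nonpos_of_nonneg (by linarith) hv
        have : 0 ≤ 2 * k * (A - B) := mul_nonneg (by positivity) (by linarith)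
        linarith
      · have h6 : η / 2 * (A + B) ≤ 2 * k := by nlinarith
        rw [hv']
        nlinarith [mul_le_mul_of_nonneg_right h6 (sub_nonneg.mpr hBA)]
    linarith

/-- The power mean inequality for exponents in `(0, 1]`, in logarithmic form. -/
theorem log_sum_rpow_le {ι : Type*} (s : Finset ι) (z : ι → ℝ) {r : ℝ} (hr0 : 0 < r) (hr1 : r ≤ 1)
    (hz : ∀ a ∈ s, 0 ≤ z a) (hpos : ∃ a ∈ s, 0 < z a) :
    Real.log (∑ a ∈ s, z a ^ r) ≤ (1 - r) * Real.log s.card + r * Real.log (∑ a ∈ s, z a) := by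
  obtain ⟨a₀, ha₀, hza₀⟩ := hpos
  have hN : (0 : ℝ) < s.card := by exact_mod_cast Finset.card_pos.mpr ⟨a₀, ha₀⟩
  have hS : 0 < ∑ a ∈ s, z a := Finset.sum_pos' hz ⟨a₀, ha₀, hza₀⟩
  have hSr : 0 < ∑ a ∈ s, z a ^ r :=
    Finset.sum_pos' (fun a ha => Real.rpow_nonneg (hz a ha) r) ⟨a₀, ha₀, Real.rpow_pos_of_pos hza₀ r⟩
  have hJ := (Real.concaveOn_rpow hr0.le hr1).le_map_sum (t := s)
    (w := fun _ => (s.card : ℝ)⁻¹) (p := z) (fun _ _ => by positivity)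
    (by simp [hN.ne']) (fun a ha => hz a ha)
  simp only [smul_eq_mul, ← Finset.mul_sum] at hJ
  have hL := Real.log_le_log (by positivity) hJ
  rw [Real.log_mul (by positivity) hSr.ne', Real.log_rpow (by positivity),
    Real.log_mul (by positivity) hS.ne', Real.log_inv] at hL
  linarith

/-- Averaging over labels agrees with averaging over states. -/
theorem sum_fiber_div_mul {ι κ : Type*} [Fintype κ] [DecidableEq κ] (s : Finset ι) (f : ι → κ)
    (w : ι → ℝ) (g : κ → ℝ) :
    ∑ m, (∑ a ∈ s.filter (fun a => f a = m), w a) /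
        (∑ m', ∑ a ∈ s.filter (fun a => f a = m'), w a) * g m =
      (∑ a ∈ s, w a * g (f a)) / ∑ a ∈ s, w a := by
  rw [Finset.sum_fiberwise, ← Finset.sum_fiberwise s f (fun a => w a * g (f a)), Finset.sum_div]
  refine Finset.sum_congr rfl fun m _ => ?_
  rw [div_mul_eq_mul_div, Finset.sum_mul]
  congr 1
  refine Finset.sum_congr rfl fun a ha => ?_
  rw [(Finset.mem_filter.mp ha).2]


/-- Corollary to Theorem (thm:12) of the paper: the `O(Δ√(WT))` full-feedback
regret bound when the per-round loss ranges are uniformly bounded by `Δ`. -/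
theorem stmt_13 (M T : ℕ) [NeZero M] (hM : 1 ≤ M) (hT : 1 ≤ T)
    (l : ℕ → Fin M → ℝ)
    (W : ℝ) (hW : 1 ≤ W)
    {Λ : Type} (Ω : ℕ → Finset Λ)
    (hΩne : ∀ t, t ≤ T → (Ω t).Nonempty)
    (hΩ0 : (Ω 0).card = 1)
    (lab : ℕ → Λ → Fin M)
    (Tr : ℕ → Λ → Λ → ℝ)
    (hTr0 : ∀ t a b, 0 ≤ Tr t a b)
    (hTr1 : ∀ t, 1 ≤ t → t ≤ T → ∀ a ∈ Ω (t - 1), ∑ b ∈ Ω t, Tr t a b = 1)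
    (φ : ℕ → Fin M → ℝ) (η V D : ℕ → ℝ)
    (w z : ℕ → Λ → ℝ) (p : ℕ → Fin M → ℝ)
    (hp : ∀ t, 1 ≤ t → t ≤ T → ∀ m,
      p t m = (∑ a ∈ (Ω t).filter (fun a => lab t a = m), w t a) /
        ∑ m' : Fin M, ∑ a ∈ (Ω t).filter (fun a => lab t a = m'), w t a)
    (hφ : ∀ t, 1 ≤ t → t ≤ T → ∀ m,
      φ t m = l t m - Finset.univ.inf' Finset.univ_nonempty (l t))
    (hV : ∀ t, 1 ≤ t → t ≤ T →
      V t = ∑ t' ∈ Finset.Icc 1 t, ∑ m, p t' m * (φ t' m) ^ 2)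
    (hD : ∀ t, ∀ ht1 : 1 ≤ t, t ≤ T →
      D t = (Finset.Icc 1 t).sup' (Finset.nonempty_Icc.mpr ht1)
        (fun t' => Finset.univ.sup' Finset.univ_nonempty (φ t') -
          Finset.univ.inf' Finset.univ_nonempty (φ t')))
    (hη : ∀ t, 1 ≤ t → t ≤ T →
      η t = min (Real.sqrt W / Real.sqrt (V t)) (W / D t))
    (hη0 : η 0 = η 1)
    (hV1 : 0 < V 1) (hD1 : 0 < D 1)
    (hw0 : ∀ a ∈ Ω 0, w 0 a = 1)
    (hz0 : ∀ a ∈ Ω 0, z 0 a = 1)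
    (hw : ∀ t, 1 ≤ t → t ≤ T → ∀ a ∈ Ω t,
      w t a = ∑ b ∈ Ω (t - 1), Tr t b a * z (t - 1) b ^ (η (t - 1) / η (t - 2)))
    (hz : ∀ t, 1 ≤ t → t ≤ T → ∀ a ∈ Ω t,
      z t a = w t a * Real.exp (-η (t - 1) * φ t (lab t a)))
    (lam : ℕ → Λ)
    (hlam : ∀ t, t ≤ T → lam t ∈ Ω t)
    (hlamTr : ∀ t, 1 ≤ t → t ≤ T → 0 < Tr t (lam (t - 1)) (lam t))
    (hcomp : Real.log (((Finset.Icc 1 T).sup fun t => (Ω (t - 1)).card : ℕ) : ℝ)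
      - Real.log (∏ t ∈ Finset.Icc 1 T, Tr t (lam (t - 1)) (lam t)) ≤ W)
    (Δ : ℝ)
    (hΔ : ∀ t, 1 ≤ t → t ≤ T →
      Finset.univ.sup' Finset.univ_nonempty (l t) -
        Finset.univ.inf' Finset.univ_nonempty (l t) ≤ Δ) :
    ∑ t ∈ Finset.Icc 1 T, ((∑ m, p t m * l t m) - l t (lab t (lam t))) ≤
      6 * Δ * Real.sqrt (W * T) := by
  have hφ0 : ∀ t, 1 ≤ t → t ≤ T → ∀ m, 0 ≤ φ t m := fun t h1 h2 m => by
    rw [hφ t h1 h2, sub_nonneg]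
    exact Finset.inf'_le _ (Finset.mem_univ m)
  have hφΔ : ∀ t, 1 ≤ t → t ≤ T → ∀ m, φ t m ≤ Δ := fun t h1 h2 m => by
    have := Finset.le_sup' (l t) (Finset.mem_univ m)
    have := hΔ t h1 h2
    rw [hφ t h1 h2]
    linarith
  have hΔ0 : 0 ≤ Δ := (hφ0 1 le_rfl hT 0).trans (hφΔ 1 le_rfl hT 0)
  -- signs of the weights
  have hz_nonneg : ∀ t, t ≤ T → ∀ a ∈ Ω t, 0 ≤ w t a ∧ 0 ≤ z t a := by
    intro t
    induction t with
    | zero => exact fun _ a ha => by simp [hw0 a ha, hz0 a ha]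
    | succ n ih =>
      intro hn a ha
      have hwa : 0 ≤ w (n + 1) a := by
        rw [hw (n + 1) (by omega) hn a ha]
        exact Finset.sum_nonneg fun b hb =>
          mul_nonneg (hTr0 _ _ _) (Real.rpow_nonneg (ih (by omega) b hb).2 _)
      refine ⟨hwa, ?_⟩
      rw [hz (n + 1) (by omega) hn a ha]
      exact mul_nonneg hwa (Real.exp_pos _).le
  have hlam_step : ∀ n, n + 1 ≤ T → Tr (n + 1) (lam n) (lam (n + 1)) *
      z n (lam n) ^ (η n / η (n - 1)) ≤ w (n + 1) (lam (n + 1)) := by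
    intro n hn
    rw [hw (n + 1) (by omega) hn _ (hlam _ hn)]
    exact Finset.single_le_sum (f := fun b => Tr (n + 1) b (lam (n + 1)) *
      z n b ^ (η n / η (n - 1))) (fun b hb =>
        mul_nonneg (hTr0 _ _ _) (Real.rpow_nonneg (hz_nonneg n (by omega) b hb).2 _))
      (hlam n (by omega))
  have hlam_pos : ∀ t, t ≤ T → 0 < w t (lam t) ∧ 0 < z t (lam t) := by
    intro t
    induction t with
    | zero => exact fun h => by simp [hw0 _ (hlam 0 h), hz0 _ (hlam 0 h)]
    | succ n ih =>
      intro hn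
      have hwl : 0 < w (n + 1) (lam (n + 1)) :=
        (mul_pos (hlamTr (n + 1) (by omega) hn)
          (Real.rpow_pos_of_pos (ih (by omega)).2 _)).trans_le (hlam_step n hn)
      refine ⟨hwl, ?_⟩
      rw [hz (n + 1) (by omega) hn _ (hlam _ hn)]
      exact mul_pos hwl (Real.exp_pos _)
  have hP : ∀ t, t ≤ T → 0 < ∑ a ∈ Ω t, w t a := fun t ht =>
    Finset.sum_pos' (fun a ha => (hz_nonneg t ht a ha).1) ⟨lam t, hlam t ht, (hlam_pos t ht).1⟩
  have hR : ∀ t, t ≤ T → z t (lam t) ≤ ∑ a ∈ Ω t, z t a := fun t ht =>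
    Finset.single_le_sum (f := z t) (fun a ha => (hz_nonneg t ht a ha).2) (hlam t ht)
  -- the label distribution
  have hmean : ∀ t, 1 ≤ t → t ≤ T → ∀ g : Fin M → ℝ, ∑ m, p t m * g m =
      (∑ a ∈ Ω t, w t a * g (lab t a)) / ∑ a ∈ Ω t, w t a := by
    intro t h1 h2 g
    rw [← sum_fiber_div_mul]
    exact Finset.sum_congr rfl fun m _ => by rw [hp t h1 h2]
  have hp_sum : ∀ t, 1 ≤ t → t ≤ T → ∑ m, p t m = 1 := by
    intro t h1 h2
    have h := hmean t h1 h2 fun _ => 1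
    simp only [mul_one] at h
    rw [h, div_self (hP t h2).ne']
  have hv0 : ∀ t, 1 ≤ t → t ≤ T → 0 ≤ ∑ m, p t m * φ t m ^ 2 := by
    intro t h1 h2
    rw [hmean t h1 h2 fun m => φ t m ^ 2]
    exact div_nonneg (Finset.sum_nonneg fun a ha =>
      mul_nonneg (hz_nonneg t h2 a ha).1 (sq_nonneg _)) (hP t h2).le
  have hvΔ : ∀ t, 1 ≤ t → t ≤ T → ∑ m, p t m * φ t m ^ 2 ≤ Δ ^ 2 := by
    intro t h1 h2
    rw [hmean t h1 h2 fun m => φ t m ^ 2, div_le_iff₀ (hP t h2), Finset.mul_sum]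
    refine Finset.sum_le_sum fun a ha => ?_
    rw [mul_comm]
    exact mul_le_mul_of_nonneg_right
      (pow_le_pow_left₀ (hφ0 t h1 h2 _) (hφΔ t h1 h2 _) 2) (hz_nonneg t h2 a ha).1
  -- learning rates
  set U : ℕ → ℝ := fun n => ∑ t ∈ Finset.Icc 1 n, ∑ m, p t m * φ t m ^ 2 with hU
  have hU0 : U 0 = 0 := by simp [hU]
  have hUsucc : ∀ n, U (n + 1) = U n + ∑ m, p (n + 1) m * φ (n + 1) m ^ 2 := fun n =>
    Finset.sum_Icc_succ_top (by omega) _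
  have hU_nonneg : ∀ n, n ≤ T → 0 ≤ U n := fun n hn => Finset.sum_nonneg fun t ht =>
    hv0 t (Finset.mem_Icc.mp ht).1 ((Finset.mem_Icc.mp ht).2.trans hn)
  have hVU : ∀ t, 1 ≤ t → t ≤ T → V t = U t := hV
  have hUT : ∀ n, n ≤ T → U n ≤ T * Δ ^ 2 := by
    intro n hn
    have h := Finset.sum_le_card_nsmul (Finset.Icc 1 n)
      (fun t => ∑ m, p t m * φ t m ^ 2) (Δ ^ 2) (fun t ht =>
        hvΔ t (Finset.mem_Icc.mp ht).1 ((Finset.mem_Icc.mp ht).2.trans hn))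
    rw [Nat.card_Icc, Nat.add_sub_cancel, nsmul_eq_mul] at h
    have hnT : (n : ℝ) ≤ T := by exact_mod_cast hn
    exact h.trans (mul_le_mul_of_nonneg_right hnT (sq_nonneg _))
  have hVmono : ∀ n, 1 ≤ n → n + 1 ≤ T → V n ≤ V (n + 1) := by
    intro n h1 h2
    rw [hVU n h1 (by omega), hVU (n + 1) (by omega) h2, hUsucc]
    linarith [hv0 (n + 1) (by omega) h2]
  have hDmono : ∀ n, 1 ≤ n → n + 1 ≤ T → D n ≤ D (n + 1) := by
    intro n h1 h2
    rw [hD n h1 (by omega), hD (n + 1) (by omega) h2]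
    exact Finset.sup'_mono _ (Finset.Icc_subset_Icc_right (by omega)) _
  have hVD_pos : ∀ n, 1 ≤ n → n ≤ T → 0 < V n ∧ 0 < D n := by
    intro n h1
    induction n, h1 using Nat.le_induction with
    | base => exact fun _ => ⟨hV1, hD1⟩
    | succ n h1 ih =>
      intro h2
      have := ih (by omega)
      exact ⟨this.1.trans_le (hVmono n h1 h2), this.2.trans_le (hDmono n h1 h2)⟩
  have hDΔ : ∀ n, 1 ≤ n → n ≤ T → D n ≤ Δ := by
    intro n h1 h2
    rw [hD n h1 h2]
    refine Finset.sup'_le _ _ fun t ht => ?_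
    have ht1 := (Finset.mem_Icc.mp ht).1
    have ht2 := (Finset.mem_Icc.mp ht).2.trans h2
    have hs : Finset.univ.sup' Finset.univ_nonempty (φ t) ≤ Δ :=
      Finset.sup'_le _ _ fun m _ => hφΔ t ht1 ht2 m
    have hi : 0 ≤ Finset.univ.inf' Finset.univ_nonempty (φ t) :=
      Finset.le_inf' _ _ fun m _ => hφ0 t ht1 ht2 m
    linarith
  have hW0 : 0 < W := by linarith
  have hηpos : ∀ n, n ≤ T → 0 < η n := by
    have h : ∀ n, 1 ≤ n → n ≤ T → 0 < η n := fun n h1 h2 => by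
      obtain ⟨hv, hd⟩ := hVD_pos n h1 h2
      rw [hη n h1 h2]
      exact lt_min (by positivity) (by positivity)
    rintro (_ | n) hn
    · rw [hη0]; exact h 1 le_rfl hT
    · exact h _ (by omega) hn
  have hηanti : ∀ n, n + 1 ≤ T → η (n + 1) ≤ η n := by
    rintro (_ | n) hn
    · exact hη0.ge
    · obtain ⟨hv, hd⟩ := hVD_pos (n + 1) (by omega) (by omega)
      rw [hη (n + 1) (by omega) (by omega), hη (n + 1 + 1) (by omega) hn]
      have hv' := Real.sqrt_le_sqrt (hVmono (n + 1) (by omega) hn)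
      exact min_le_min
        (div_le_div_of_nonneg_left (Real.sqrt_nonneg _) (Real.sqrt_pos.mpr hv) hv')
        (div_le_div_of_nonneg_left hW0.le hd (hDmono (n + 1) (by omega) hn))
  have hηU : ∀ n, n ≤ T → 0 < U n → η n ≤ Real.sqrt W / Real.sqrt (U n) := by
    intro n hn hpos
    rcases Nat.eq_zero_or_pos n with rfl | h1
    · exact absurd hpos (by rw [hU0]; exact lt_irrefl _)
    · rw [hη n h1 hn, hVU n h1 hn]
      exact min_le_left _ _
  have hsqU : ∀ n, n ≤ T → Real.sqrt W * Real.sqrt (U n) ≤ Δ * Real.sqrt (W * T) := by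
    intro n hn
    have h1 : Real.sqrt (U n) ≤ Real.sqrt T * Δ := by
      have h := Real.sqrt_le_sqrt (hUT n hn)
      rwa [Real.sqrt_mul (Nat.cast_nonneg T), Real.sqrt_sq hΔ0] at h
    rw [Real.sqrt_mul hW0.le]
    calc Real.sqrt W * Real.sqrt (U n) ≤ Real.sqrt W * (Real.sqrt T * Δ) :=
          mul_le_mul_of_nonneg_left h1 (Real.sqrt_nonneg _)
      _ = _ := by ring
  have hWη : ∀ n, n ≤ T → W / η n ≤ Δ * Real.sqrt (W * T) := by
    have h : ∀ n, 1 ≤ n → n ≤ T → W / η n ≤ Δ * Real.sqrt (W * T) := by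
      intro n h1 h2
      obtain ⟨hv, hd⟩ := hVD_pos n h1 h2
      rcases min_choice (Real.sqrt W / Real.sqrt (V n)) (W / D n) with hm | hm
      · have hV' : W / (Real.sqrt W / Real.sqrt (V n)) = Real.sqrt W * Real.sqrt (V n) := by
          rw [div_div_eq_mul_div, mul_div_right_comm, Real.div_sqrt]
        rw [hη n h1 h2, hm, hV', hVU n h1 h2]
        exact hsqU n h2
      · have hWT : 1 ≤ Real.sqrt (W * T) := by
          have hT' : (1 : ℝ) ≤ T := by exact_mod_cast hT
          exact Real.one_le_sqrt.mpr (one_le_mul_of_one_le_of_one_le hW hT')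
        rw [hη n h1 h2, hm, div_div_cancel₀ hW0.ne']
        exact (hDΔ n h1 h2).trans (le_mul_of_one_le_right hΔ0 hWT)
    rintro (_ | n) hn
    · rw [hη0]; exact h 1 le_rfl hT
    · exact h _ (by omega) hn
  -- per-round comparison with the mix loss
  have hround : ∀ n, n + 1 ≤ T → ∑ m, p (n + 1) m * φ (n + 1) m ≤
      (Real.log (∑ a ∈ Ω (n + 1), w (n + 1) a) -
        Real.log (∑ a ∈ Ω (n + 1), z (n + 1) a)) / η n +
      2 * Real.sqrt W * (Real.sqrt (U (n + 1)) - Real.sqrt (U n)) := by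
    intro n hn
    have hzsum : ∑ a ∈ Ω (n + 1), z (n + 1) a = ∑ a ∈ Ω (n + 1), w (n + 1) a *
        Real.exp (-η n * φ (n + 1) (lab (n + 1) a)) :=
      Finset.sum_congr rfl fun a ha => hz (n + 1) (by omega) hn a ha
    have hwn : ∀ a ∈ Ω (n + 1), 0 ≤ w (n + 1) a := fun a ha => (hz_nonneg _ hn a ha).1
    have hφn : ∀ a ∈ Ω (n + 1), 0 ≤ φ (n + 1) (lab (n + 1) a) :=
      fun a _ => hφ0 _ (by omega) hn _
    rw [hUsucc, hzsum, hmean (n + 1) (by omega) hn]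
    refine le_add_two_mul_sqrt_sub_sqrt hW (hU_nonneg n (by omega)) (hv0 _ (by omega) hn)
      (hηU n (by omega)) ?_ ?_
    · rw [hmean (n + 1) (by omega) hn fun m => φ (n + 1) m ^ 2]
      exact mean_le_mixLoss_add_sq _ _ _ (hηpos n (by omega)) hwn hφn (hP _ hn)
    · rw [hmean (n + 1) (by omega) hn fun m => φ (n + 1) m ^ 2]
      exact mean_le_mixLoss_add_sqrt _ _ _ (hηpos n (by omega)) hwn hφn (hP _ hn)
  -- transition of the total weight
  have hmass : ∀ n, n + 1 ≤ T → ∑ a ∈ Ω (n + 1), w (n + 1) a =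
      ∑ b ∈ Ω n, z n b ^ (η n / η (n - 1)) := by
    intro n hn
    calc ∑ a ∈ Ω (n + 1), w (n + 1) a
        = ∑ a ∈ Ω (n + 1), ∑ b ∈ Ω n, Tr (n + 1) b a * z n b ^ (η n / η (n - 1)) :=
          Finset.sum_congr rfl fun a ha => hw (n + 1) (by omega) hn a ha
      _ = ∑ b ∈ Ω n, z n b ^ (η n / η (n - 1)) := by
          rw [Finset.sum_comm]
          refine Finset.sum_congr rfl fun b hb => ?_
          rw [← Finset.sum_mul, hTr1 (n + 1) (by omega) hn b hb, one_mul]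
  set L := Real.log (((Finset.Icc 1 T).sup fun t => (Ω (t - 1)).card : ℕ) : ℝ) with hL
  have hcard : ∀ n, n + 1 ≤ T → Real.log (Ω n).card ≤ L := by
    intro n hn
    refine Real.log_le_log (by exact_mod_cast Finset.card_pos.mpr (hΩne n (by omega))) ?_
    exact_mod_cast Finset.le_sup (f := fun t => (Ω (t - 1)).card)
      (Finset.mem_Icc.mpr ⟨Nat.succ_pos n, hn⟩)
  have hL0 : 0 ≤ L := by
    have := hcard 0 hT
    rwa [hΩ0, Nat.cast_one, Real.log_one] at this
  have hupper : ∀ n, n + 1 ≤ T → ∑ t ∈ Finset.Icc 1 (n + 1), ∑ m, p t m * φ t m ≤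
      2 * Real.sqrt W * Real.sqrt (U (n + 1)) + L / η n -
        Real.log (∑ a ∈ Ω (n + 1), z (n + 1) a) / η n := by
    intro n
    induction n with
    | zero =>
      intro hn
      have h := hround 0 hn
      have hm : ∑ a ∈ Ω (0 + 1), w (0 + 1) a = 1 := by
        rw [hmass 0 hn]
        have : ∀ b ∈ Ω 0, z 0 b ^ (η 0 / η (0 - 1)) = 1 := fun b hb => by
          rw [hz0 b hb, Real.one_rpow]
        rw [Finset.sum_congr rfl this]
        simp [hΩ0]
      rw [hm, Real.log_one, hU0, Real.sqrt_zero, sub_zero, zero_sub, neg_div] at h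
      have hLη : 0 ≤ L / η 0 := div_nonneg hL0 (hηpos 0 (by omega)).le
      simp only [zero_add, Finset.Icc_self, Finset.sum_singleton] at h ⊢
      linarith
    | succ n ih =>
      intro hn
      have ih := ih (by omega)
      have h := hround (n + 1) hn
      have hη1 := hηpos (n + 1) (by omega)
      have hη2 := hηpos n (by omega)
      have hr1 : η (n + 1) / η n ≤ 1 := (div_le_one hη2).mpr (hηanti n (by omega))
      have hJ := log_sum_rpow_le (Ω (n + 1)) (z (n + 1)) (div_pos hη1 hη2) hr1
        (fun a ha => (hz_nonneg _ (by omega) a ha).2)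
        ⟨_, hlam (n + 1) (by omega), (hlam_pos (n + 1) (by omega)).2⟩
      have hm := hmass (n + 1) hn
      rw [Nat.add_sub_cancel] at hm
      rw [← hm] at hJ
      have hJ' : Real.log (∑ a ∈ Ω (n + 1 + 1), w (n + 1 + 1) a) / η (n + 1) ≤
          L / η (n + 1) - L / η n + Real.log (∑ a ∈ Ω (n + 1), z (n + 1) a) / η n := by
        rw [div_le_iff₀ hη1]
        have hc := mul_le_mul_of_nonneg_left (hcard (n + 1) hn) (sub_nonneg.mpr hr1)
        refine (hJ.trans (add_le_add_left hc _)).trans_eq ?_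
        field_simp
      rw [Finset.sum_Icc_succ_top (by omega)]
      rw [sub_div] at h
      linarith
  -- weight of the comparator path
  have hTr_le : ∀ t, 1 ≤ t → t ≤ T → Tr t (lam (t - 1)) (lam t) ≤ 1 := by
    intro t h1 h2
    rw [← hTr1 t h1 h2 _ (hlam (t - 1) (by omega))]
    exact Finset.single_le_sum (f := Tr t (lam (t - 1))) (fun b _ => hTr0 _ _ _) (hlam t h2)
  have hlog_le : ∀ t, 1 ≤ t → t ≤ T → Real.log (Tr t (lam (t - 1)) (lam t)) ≤ 0 :=
    fun t h1 h2 => Real.log_nonpos (hTr0 _ _ _) (hTr_le t h1 h2)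
  have hlogz : ∀ n, n + 1 ≤ T → Real.log (z (n + 1) (lam (n + 1))) =
      Real.log (w (n + 1) (lam (n + 1))) - η n * φ (n + 1) (lab (n + 1) (lam (n + 1))) := by
    intro n hn
    rw [hz (n + 1) (by omega) hn _ (hlam _ hn),
      Real.log_mul (hlam_pos _ hn).1.ne' (Real.exp_pos _).ne', Real.log_exp, Nat.add_sub_cancel]
    ring
  have hlogw : ∀ n, n + 1 ≤ T → Real.log (Tr (n + 1) (lam n) (lam (n + 1))) +
      η n / η (n - 1) * Real.log (z n (lam n)) ≤ Real.log (w (n + 1) (lam (n + 1))) := by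
    intro n hn
    have hTrpos : 0 < Tr (n + 1) (lam n) (lam (n + 1)) := hlamTr (n + 1) (by omega) hn
    have hzpos := (hlam_pos n (by omega)).2
    rw [← Real.log_rpow hzpos, ← Real.log_mul hTrpos.ne' (Real.rpow_pos_of_pos hzpos _).ne']
    exact Real.log_le_log (mul_pos hTrpos (Real.rpow_pos_of_pos hzpos _)) (hlam_step n hn)
  have hlower : ∀ n, n + 1 ≤ T →
      (∑ t ∈ Finset.Icc 1 (n + 1), Real.log (Tr t (lam (t - 1)) (lam t))) / η n -
        ∑ t ∈ Finset.Icc 1 (n + 1), φ t (lab t (lam t)) ≤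
      Real.log (z (n + 1) (lam (n + 1))) / η n := by
    intro n
    induction n with
    | zero =>
      intro hn
      have h := hlogw 0 hn
      rw [hz0 _ (hlam 0 (by omega)), Real.log_one, mul_zero, add_zero] at h
      have hη1 := hηpos 0 (by omega)
      rw [hlogz 0 hn, sub_div, mul_div_cancel_left₀ _ hη1.ne']
      simp only [zero_add, Finset.Icc_self, Finset.sum_singleton, Nat.sub_self] at h ⊢
      linarith [div_le_div_of_nonneg_right h hη1.le]
    | succ n ih =>
      intro hn
      have ih := ih (by omega)
      have h := hlogw (n + 1) hn
      rw [Nat.add_sub_cancel] at h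
      have hη1 := hηpos (n + 1) (by omega)
      have hη2 := hηpos n (by omega)
      have h' := div_le_div_of_nonneg_right h hη1.le
      have he : (Real.log (Tr (n + 1 + 1) (lam (n + 1)) (lam (n + 1 + 1))) +
          η (n + 1) / η n * Real.log (z (n + 1) (lam (n + 1)))) / η (n + 1) =
          Real.log (Tr (n + 1 + 1) (lam (n + 1)) (lam (n + 1 + 1))) / η (n + 1) +
          Real.log (z (n + 1) (lam (n + 1))) / η n := by
        field_simp
      have hC : ∑ t ∈ Finset.Icc 1 (n + 1), Real.log (Tr t (lam (t - 1)) (lam t)) ≤ 0 :=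
        Finset.sum_nonpos fun t ht => hlog_le t (Finset.mem_Icc.mp ht).1
          ((Finset.mem_Icc.mp ht).2.trans (by omega))
      have hC' : (∑ t ∈ Finset.Icc 1 (n + 1), Real.log (Tr t (lam (t - 1)) (lam t))) /
          η (n + 1) ≤
          (∑ t ∈ Finset.Icc 1 (n + 1), Real.log (Tr t (lam (t - 1)) (lam t))) / η n := by
        have := div_le_div_of_nonneg_left (neg_nonneg.mpr hC) hη1 (hηanti n (by omega))
        rw [neg_div, neg_div] at this
        linarith
      rw [he] at h'
      rw [hlogz (n + 1) hn, sub_div, mul_div_cancel_left₀ _ hη1.ne',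
        Finset.sum_Icc_succ_top (b := n + 1) (by omega),
        Finset.sum_Icc_succ_top (b := n + 1) (by omega), add_div, Nat.add_sub_cancel]
      linarith
  have hregret : ∑ t ∈ Finset.Icc 1 T, ((∑ m, p t m * l t m) - l t (lab t (lam t))) =
      ∑ t ∈ Finset.Icc 1 T, ∑ m, p t m * φ t m - ∑ t ∈ Finset.Icc 1 T, φ t (lab t (lam t)) := by
    rw [← Finset.sum_sub_distrib]
    refine Finset.sum_congr rfl fun t ht => ?_
    obtain ⟨h1, h2⟩ := Finset.mem_Icc.mp ht
    simp only [hφ t h1 h2, mul_sub, Finset.sum_sub_distrib, ← Finset.sum_mul, hp_sum t h1 h2]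
    ring
  rw [Real.log_prod fun t ht =>
    (hlamTr t (Finset.mem_Icc.mp ht).1 (Finset.mem_Icc.mp ht).2).ne'] at hcomp
  rw [hregret]
  obtain ⟨n, rfl⟩ : ∃ n, T = n + 1 := ⟨T - 1, by omega⟩
  have hηn := hηpos n (by omega)
  have h1 := hupper n le_rfl
  have h2 := hlower n le_rfl
  have h3 := div_le_div_of_nonneg_right
    (Real.log_le_log (hlam_pos (n + 1) le_rfl).2 (hR (n + 1) le_rfl)) hηn.le
  have h4 := div_le_div_of_nonneg_right hcomp hηn.le
  rw [sub_div] at h4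
  have h5 := hWη n (by omega)
  have h6 := hsqU (n + 1) le_rfl
  have h7 : 0 ≤ Δ * Real.sqrt (W * ((n + 1 : ℕ) : ℝ)) := mul_nonneg hΔ0 (Real.sqrt_nonneg _)
  linarith
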